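/- Let d ≥ 2 and let φ be a Minkowski linear functional on generalized permutahedra in ℝ^d, i.e., φ(∅) = 0 and φ(λP + μQ) = λφ(P) + μφ(Q) for all generalized permutahedra P, Q ⊆ ℝ^d and all reals λ, μ ≥ 0. Then the following are equivalent: (a) φ(P) ≥ 0 for every generalized permutahedron P, and φ(P + {t}) = φ(P) for every generalized permutahedron P and every t ∈ ℝ^d; (b) there exist nonnegative reals c_E^T, indexed by pairs (E, T) with E ⊆ T ⊆ [d] and |E| = 2, such that for every nonempty I ⊆ [d], φ(Δ_I) = Σ_{(E,T) : E ⊆ I ⊆ T, |E| = 2} c_E^T. -/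

import Mathlib

open Finset Pointwise

/-- The standard simplex `Δ_I ⊆ ℝ^d`: the convex hull of `{e_i : i ∈ I}`. -/
def stdSimp (d : ℕ) (I : Finset (Fin d)) : Set (Fin d → ℝ) :=
  convexHull ℝ ((fun i => (Pi.single i 1 : Fin d → ℝ)) '' (I : Set (Fin d)))

/-- The permutahedron `Π_d`: the convex hull of the points `(σ(1),…,σ(d))`. -/
def permutahedron (d : ℕ) : Set (Fin d → ℝ) :=
  convexHull ℝ {x | ∃ σ : Equiv.Perm (Fin d), x = fun i => ((σ i : ℕ) + 1 : ℝ)}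

/-- A polytope is the convex hull of a finite set of points. -/
def IsPolytope {d : ℕ} (P : Set (Fin d → ℝ)) : Prop :=
  ∃ S : Finset (Fin d → ℝ), P = convexHull ℝ (S : Set (Fin d → ℝ))

/-- A generalized permutahedron: a polytope `P` such that `P + Q = λ • Π_d`
for some polytope `Q` and some `λ > 0`. -/
def IsGenPerm {d : ℕ} (P : Set (Fin d → ℝ)) : Prop :=
  IsPolytope P ∧ ∃ lam : ℝ, 0 < lam ∧ ∃ Q : Set (Fin d → ℝ), IsPolytope Q ∧
    P + Q = lam • permutahedron d

/-- The Farkas lemma for finitely many linear functionals on a real vector space. -/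
theorem exists_nonneg_sum_smul_of_forall_nonneg {V ι : Type*} [AddCommGroup V] [Module ℝ V]
    (s : Finset ι) (f : ι → V →ₗ[ℝ] ℝ) (g : V →ₗ[ℝ] ℝ)
    (h : ∀ x, (∀ i ∈ s, 0 ≤ f i x) → 0 ≤ g x) :
    ∃ c : ι → ℝ, (∀ i, 0 ≤ c i) ∧ g = ∑ i ∈ s, c i • f i := by
  classical
  induction s using Finset.induction_on generalizing f g with
  | empty =>
    refine ⟨0, fun _ => le_rfl, LinearMap.ext fun x => ?_⟩
    have h1 := h x (by simp)
    have h2 := h (-x) (by simp)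
    simp only [map_neg] at h2
    simp only [sum_empty, LinearMap.zero_apply]
    linarith
  | insert j s hj ih =>
    by_cases hs : ∀ x, (∀ i ∈ s, 0 ≤ f i x) → 0 ≤ g x
    · obtain ⟨c, hc, rfl⟩ := ih f g hs
      refine ⟨Function.update c j 0, fun i => ?_, ?_⟩
      · by_cases hi : i = j
        · simp [hi]
        · simpa [hi] using hc i
      · rw [sum_insert hj]
        simp only [Function.update_self, zero_smul, zero_add]
        refine sum_congr rfl fun i hi => ?_
        rw [Function.update_of_ne (ne_of_mem_of_not_mem hi hj)]
    · push Not at hs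
      obtain ⟨x, hx, hgx⟩ := hs
      have hfx : f j x < 0 := by
        by_contra! hfx
        exact hgx.not_ge (h x (by simpa [hfx] using hx))
      set x₀ := (-(f j x))⁻¹ • x with hx₀
      have hpos : 0 < (-(f j x))⁻¹ := by simpa using hfx
      have hf₀ : f j x₀ = -1 := by
        simp only [hx₀, map_smul, smul_eq_mul]
        have := hfx.ne
        field_simp
      have hx₀s : ∀ i ∈ s, 0 ≤ f i x₀ := fun i hi => by
        simpa [hx₀] using mul_nonneg hpos.le (hx i hi)
      have hg₀ : g x₀ < 0 := by
        simpa [hx₀] using mul_neg_of_pos_of_neg hpos hgx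
      obtain ⟨c, hc, hgc⟩ := ih (fun i => f i + f i x₀ • f j) (g + g x₀ • f j) (fun y hy => by
        have := h (y + f j y • x₀) (fun i hi => by
          rcases mem_insert.1 hi with rfl | hi
          · simp [hf₀]
          · simpa [mul_comm] using hy i hi)
        simpa [mul_comm] using this)
      have hnn : 0 ≤ ∑ i ∈ s, c i * f i x₀ - g x₀ := by
        have := sum_nonneg fun i hi => mul_nonneg (hc i) (hx₀s i hi)
        linarith
      refine ⟨Function.update c j (∑ i ∈ s, c i * f i x₀ - g x₀), fun i => ?_, ?_⟩
      · by_cases hi : i = j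
        · simpa [hi] using hnn
        · simpa [hi] using hc i
      · have hupd : ∀ k : ℝ, ∑ i ∈ s, Function.update c j k i • f i = ∑ i ∈ s, c i • f i :=
          fun k => sum_congr rfl fun i hi => by
            rw [Function.update_of_ne (ne_of_mem_of_not_mem hi hj)]
        rw [sum_insert hj, Function.update_self, hupd]
        refine LinearMap.ext fun y => ?_
        have := LinearMap.congr_fun hgc y
        simp only [LinearMap.add_apply, LinearMap.smul_apply, smul_eq_mul, LinearMap.coe_sum,
          Finset.sum_apply, mul_add, sum_add_distrib, ← mul_assoc, ← sum_mul] at this ⊢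
        linarith

/-- The indicator vector of a set of coordinates. -/
def indVec {d : ℕ} (I : Finset (Fin d)) : Fin d → ℝ := fun i => if i ∈ I then 1 else 0

theorem indVec_dotProduct {d : ℕ} (I : Finset (Fin d)) (x : Fin d → ℝ) :
    indVec I ⬝ᵥ x = ∑ i ∈ I, x i := by
  simp [indVec, dotProduct, sum_ite_mem]

/-- Every nonnegative vector is built from `0` by successively adding positive multiples of
indicator vectors of its support. -/
theorem nonneg_induction {d : ℕ} {p : (Fin d → ℝ) → Prop} (zero : p 0)
    (step : ∀ (u : Fin d → ℝ) (I : Finset (Fin d)) (m : ℝ), 0 ≤ u → 0 < m →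
      (∀ i ∉ I, u i = 0) → p u → p (u + m • indVec I)) (u : Fin d → ℝ) (hu : 0 ≤ u) : p u := by
  induction hn : #{i | 0 < u i} using Nat.strong_induction_on generalizing u with
  | _ n ih =>
    set I : Finset (Fin d) := {i | 0 < u i} with hI
    have hI0 : ∀ i ∉ I, u i = 0 := fun i hi => by
      have : ¬ 0 < u i := by simpa [hI] using hi
      exact le_antisymm (not_lt.1 this) (hu i)
    rcases I.eq_empty_or_nonempty with h | h
    · have : u = 0 := funext fun i => hI0 i (by simp [h])
      rwa [this]
    · obtain ⟨j, hj, hmin⟩ := exists_min_image I u h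
      have hjpos : 0 < u j := by simpa [hI] using hj
      set v : Fin d → ℝ := u - u j • indVec I with hv
      have hvI : ∀ i ∈ I, v i = u i - u j := fun i hi => by simp [hv, indVec, hi]
      have hv0 : ∀ i ∉ I, v i = 0 := fun i hi => by simp [hv, indVec, hi, hI0 i hi]
      have hvnn : 0 ≤ v := fun i => by
        by_cases hi : i ∈ I
        · simpa [hvI i hi] using hmin i hi
        · simp [hv0 i hi]
      have huv : u = v + u j • indVec I := by simp [hv]
      rw [huv]
      refine step v I _ hvnn hjpos hv0 (ih _ ?_ v hvnn rfl)
      rw [← hn]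
      refine card_lt_card ⟨fun i hi => ?_, fun hsub => ?_⟩
      · by_contra hiI
        simp [hv0 i hiI] at hi
      · have := hsub hj
        simp [hvI j hj] at this

/-- A function on `ℝ^d` that is positively homogeneous and additive on comonotone vectors,
that is, linear on every cone of the braid fan. -/
structure IsBraidLinear {d : ℕ} (f : (Fin d → ℝ) → ℝ) : Prop where
  smul : ∀ (c : ℝ) (u : Fin d → ℝ), 0 ≤ c → f (c • u) = c * f u
  add : ∀ u v : Fin d → ℝ, Monovary u v → f (u + v) = f u + f v

namespace IsBraidLinear

variable {d : ℕ} {f g : (Fin d → ℝ) → ℝ}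

theorem map_zero (hf : IsBraidLinear f) : f 0 = 0 := by
  simpa using hf.smul 0 0 le_rfl

theorem eq_of_indVec (hf : IsBraidLinear f) (hg : IsBraidLinear g)
    (h : ∀ I, f (indVec I) = g (indVec I)) : f = g := by
  have hnn : ∀ u : Fin d → ℝ, 0 ≤ u → f u = g u := by
    refine nonneg_induction (by rw [hf.map_zero, hg.map_zero]) fun u I m hu hm hI hfg => ?_
    have hmono : Monovary u (m • indVec I) := fun i j hij => by
      by_cases hi : i ∈ I
      · by_cases hj : j ∈ I <;> simp [indVec, hi, hj] at hij
        linarith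
      · rw [hI i hi]
        exact hu j
    rw [hf.add _ _ hmono, hg.add _ _ hmono, hf.smul _ _ hm.le, hg.smul _ _ hm.le, hfg, h]
  funext u
  obtain ⟨c, hc⟩ : ∃ c : ℝ, ∀ i, -c ≤ u i :=
    ⟨∑ i, |u i|, fun i => by
      have := single_le_sum (fun j _ => abs_nonneg (u j)) (mem_univ i)
      linarith [neg_abs_le (u i)]⟩
  have hmono : Monovary u (fun _ : Fin d => c) := fun i j hij => absurd hij (lt_irrefl _)
  have hmono' : Monovary (u + fun _ => c) (fun _ : Fin d => -c) :=
    fun i j hij => absurd hij (lt_irrefl _)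
  have hu : u = (u + fun _ => c) + fun _ => -c := by ext; simp
  have hpos : f (u + fun _ => c) = g (u + fun _ => c) := hnn _ fun i => by
    simpa using by linarith [hc i]
  have hconst : ∀ k : ℝ, f (fun _ => k) = g (fun _ => k) := fun k => by
    rcases le_total 0 k with hk | hk
    · exact hnn _ fun _ => hk
    · have hm : Monovary (fun _ : Fin d => k) (fun _ : Fin d => -k) :=
        fun i j hij => absurd hij (lt_irrefl _)
      have h0 : (fun _ : Fin d => k) + (fun _ => -k) = 0 := by ext; simp
      have h1 := hf.add _ _ hm
      have h2 := hg.add _ _ hm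
      rw [h0, hf.map_zero] at h1
      rw [h0, hg.map_zero] at h2
      have h3 : f (fun _ => -k) = g (fun _ => -k) := hnn _ fun _ => by simpa using hk
      linarith
  rw [hu, hf.add _ _ hmono', hg.add _ _ hmono', hpos, hconst]

end IsBraidLinear

/-- The lower support function `u ↦ min_{x ∈ P} ⟨u, x⟩`. -/
noncomputable def lowerSupport {d : ℕ} (P : Set (Fin d → ℝ)) (u : Fin d → ℝ) : ℝ :=
  sInf ((fun x => u ⬝ᵥ x) '' P)

section lowerSupport

variable {d : ℕ} {P Q : Set (Fin d → ℝ)}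

theorem bddBelow_dotProduct_image (hP : IsCompact P) (u : Fin d → ℝ) :
    BddBelow ((fun x => u ⬝ᵥ x) '' P) :=
  (hP.image (by unfold dotProduct; fun_prop)).bddBelow

theorem lowerSupport_le (hP : IsCompact P) (u : Fin d → ℝ) {x : Fin d → ℝ} (hx : x ∈ P) :
    lowerSupport P u ≤ u ⬝ᵥ x :=
  csInf_le (bddBelow_dotProduct_image hP u) ⟨x, hx, rfl⟩

theorem le_lowerSupport (hP : P.Nonempty) {u : Fin d → ℝ} {c : ℝ} (h : ∀ x ∈ P, c ≤ u ⬝ᵥ x) :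
    c ≤ lowerSupport P u :=
  le_csInf (hP.image _) (by rintro _ ⟨x, hx, rfl⟩; exact h x hx)

theorem lowerSupport_eq_of_forall_le (hP : IsCompact P) {u x : Fin d → ℝ} (hx : x ∈ P)
    (h : ∀ y ∈ P, u ⬝ᵥ x ≤ u ⬝ᵥ y) : lowerSupport P u = u ⬝ᵥ x :=
  le_antisymm (lowerSupport_le hP u hx) (le_lowerSupport ⟨x, hx⟩ h)

theorem lowerSupport_add_set (hP : IsCompact P) (hP' : P.Nonempty) (hQ : IsCompact Q)
    (hQ' : Q.Nonempty) (u : Fin d → ℝ) :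
    lowerSupport (P + Q) u = lowerSupport P u + lowerSupport Q u := by
  unfold lowerSupport
  rw [← csInf_add (hP'.image _) (bddBelow_dotProduct_image hP u) (hQ'.image _)
    (bddBelow_dotProduct_image hQ u)]
  congr 1
  exact Set.image_image2_distrib fun x y => dotProduct_add u x y

theorem lowerSupport_smul_set {c : ℝ} (hc : 0 ≤ c) (u : Fin d → ℝ) :
    lowerSupport (c • P) u = c * lowerSupport P u := by
  unfold lowerSupport
  rw [← smul_eq_mul, ← Real.sInf_smul_of_nonneg hc]
  congr 1
  ext y
  simp [Set.mem_smul_set]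

theorem lowerSupport_smul (P : Set (Fin d → ℝ)) {c : ℝ} (hc : 0 ≤ c) (u : Fin d → ℝ) :
    lowerSupport P (c • u) = c * lowerSupport P u := by
  rw [← lowerSupport_smul_set hc]
  unfold lowerSupport
  congr 1
  ext y
  simp [Set.mem_smul_set]

theorem lowerSupport_superadditive (hP : IsCompact P) (hP' : P.Nonempty) (u v : Fin d → ℝ) :
    lowerSupport P u + lowerSupport P v ≤ lowerSupport P (u + v) :=
  le_lowerSupport hP' fun x hx => by
    rw [add_dotProduct]
    exact add_le_add (lowerSupport_le hP u hx) (lowerSupport_le hP v hx)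

theorem subset_of_lowerSupport_le (hP : IsCompact P) (hQ : IsCompact Q) (hQc : Convex ℝ Q)
    (hQ' : Q.Nonempty) (h : ∀ u, lowerSupport Q u ≤ lowerSupport P u) : P ⊆ Q := by
  intro x hx
  by_contra hxQ
  obtain ⟨f, s, hfx, hfQ⟩ := geometric_hahn_banach_point_closed hQc hQ.isClosed hxQ
  set u : Fin d → ℝ := fun i => f (Pi.single i 1) with hu
  have hf : ∀ y, f y = u ⬝ᵥ y := fun y => by
    conv_lhs => rw [← univ_sum_single y]
    rw [map_sum]
    refine sum_congr rfl fun i _ => ?_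
    rw [hu, show (Pi.single i (y i) : Fin d → ℝ) = y i • Pi.single i 1 by simp [← Pi.single_smul],
      map_smul, smul_eq_mul, mul_comm]
  have h1 : s ≤ lowerSupport Q u := le_lowerSupport hQ' fun y hy => by
    rw [← hf]; exact (hfQ y hy).le
  have h2 := lowerSupport_le hP u hx
  rw [← hf] at h2
  linarith [h u]

theorem eq_of_lowerSupport_eq (hP : IsCompact P) (hPc : Convex ℝ P) (hP' : P.Nonempty)
    (hQ : IsCompact Q) (hQc : Convex ℝ Q) (hQ' : Q.Nonempty)
    (h : lowerSupport P = lowerSupport Q) : P = Q :=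
  (subset_of_lowerSupport_le hP hQ hQc hQ' fun u => (congrFun h u).ge).antisymm
    (subset_of_lowerSupport_le hQ hP hPc hP' fun u => (congrFun h u).le)

theorem IsPolytope.isCompact (h : IsPolytope P) : IsCompact P := by
  obtain ⟨S, rfl⟩ := h
  exact S.finite_toSet.isCompact_convexHull ℝ

theorem IsPolytope.convex (h : IsPolytope P) : Convex ℝ P := by
  obtain ⟨S, rfl⟩ := h
  exact convex_convexHull ℝ _

theorem IsPolytope.add (hP : IsPolytope P) (hQ : IsPolytope Q) : IsPolytope (P + Q) := by
  classical
  obtain ⟨S, rfl⟩ := hP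
  obtain ⟨T, rfl⟩ := hQ
  exact ⟨S + T, by rw [coe_add, convexHull_add]⟩

theorem IsPolytope.smul (hP : IsPolytope P) (c : ℝ) : IsPolytope (c • P) := by
  classical
  obtain ⟨S, rfl⟩ := hP
  exact ⟨S.image (c • ·), by rw [coe_image, Set.image_smul, convexHull_smul]⟩

theorem isPolytope_singleton (t : Fin d → ℝ) : IsPolytope {t} :=
  ⟨{t}, by simp⟩

end lowerSupport

/-- A nonempty compact convex set whose lower support function is linear on the cones of the
braid fan. -/
structure IsBraidBody {d : ℕ} (P : Set (Fin d → ℝ)) : Prop where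
  isCompact : IsCompact P
  convex : Convex ℝ P
  nonempty : P.Nonempty
  lowerSupport_add : ∀ u v : Fin d → ℝ, Monovary u v →
    lowerSupport P (u + v) = lowerSupport P u + lowerSupport P v

namespace IsBraidBody

variable {d : ℕ} {P Q : Set (Fin d → ℝ)}

theorem isBraidLinear (hP : IsBraidBody P) : IsBraidLinear (lowerSupport P) :=
  ⟨fun _ u hc => lowerSupport_smul P hc u, hP.lowerSupport_add⟩

theorem eq_of_indVec (hP : IsBraidBody P) (hQ : IsBraidBody Q)
    (h : ∀ I, lowerSupport P (indVec I) = lowerSupport Q (indVec I)) : P = Q :=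
  eq_of_lowerSupport_eq hP.isCompact hP.convex hP.nonempty hQ.isCompact hQ.convex hQ.nonempty
    (hP.isBraidLinear.eq_of_indVec hQ.isBraidLinear h)

theorem add (hP : IsBraidBody P) (hQ : IsBraidBody Q) : IsBraidBody (P + Q) where
  isCompact := hP.isCompact.add hQ.isCompact
  convex := hP.convex.add hQ.convex
  nonempty := hP.nonempty.add hQ.nonempty
  lowerSupport_add u v huv := by
    simp only [lowerSupport_add_set hP.isCompact hP.nonempty hQ.isCompact hQ.nonempty,
      hP.lowerSupport_add u v huv, hQ.lowerSupport_add u v huv]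
    ring

theorem smul (hP : IsBraidBody P) {c : ℝ} (hc : 0 ≤ c) : IsBraidBody (c • P) where
  isCompact := hP.isCompact.smul c
  convex := hP.convex.smul c
  nonempty := hP.nonempty.smul_set
  lowerSupport_add u v huv := by
    simp only [lowerSupport_smul_set hc, hP.lowerSupport_add u v huv, mul_add]

/-- A Minkowski summand of a braid body is a braid body. -/
theorem of_add (hPc : IsCompact P) (hP : Convex ℝ P) (hQc : IsCompact Q)
    (h : IsBraidBody (P + Q)) : IsBraidBody P where
  isCompact := hPc
  convex := hP
  nonempty := h.nonempty.of_add_left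
  lowerSupport_add u v huv := by
    have hP' := h.nonempty.of_add_left
    have hQ' := h.nonempty.of_add_right
    have := h.lowerSupport_add u v huv
    simp only [lowerSupport_add_set hPc hP' hQc hQ'] at this
    linarith [lowerSupport_superadditive hPc hP' u v, lowerSupport_superadditive hQc hQ' u v]

theorem lowerSupport_empty (hP : IsBraidBody P) : lowerSupport P (indVec ∅) = 0 := by
  rw [← hP.isBraidLinear.map_zero]
  congr 1

/-- The lower support function of a braid body is supermodular on indicator vectors. -/
theorem supermodular (hP : IsBraidBody P) {S : Finset (Fin d)} {a b : Fin d} (ha : a ∉ S)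
    (hab : a ≠ b) :
    lowerSupport P (indVec (insert a S)) + lowerSupport P (indVec (insert b S)) ≤
      lowerSupport P (indVec (insert a (insert b S))) + lowerSupport P (indVec S) := by
  have hmono : Monovary (indVec (insert a (insert b S))) (indVec S) := fun i j hij => by
    by_cases hj : j ∈ S
    · simp only [indVec, mem_insert, hj, or_true, if_true]
      split_ifs <;> norm_num
    · by_cases hi : i ∈ S <;> simp [indVec, hi, hj] at hij
      linarith
  rw [← hP.lowerSupport_add _ _ hmono]
  have : indVec (insert a (insert b S)) + indVec S = indVec (insert a S) + indVec (insert b S) := by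
    ext i
    by_cases hi : i ∈ S
    · simp [indVec, hi]
    · by_cases hia : i = a
      · subst hia; simp [indVec, hi, hab]
      · simp [indVec, hi, hia]
  rw [this]
  exact lowerSupport_superadditive hP.isCompact hP.nonempty _ _

end IsBraidBody

/-- Local form of supermodularity of a set function. -/
def IsSupermodular {d : ℕ} (z : Finset (Fin d) → ℝ) : Prop :=
  ∀ (S : Finset (Fin d)) (a b : Fin d), a ∉ S → b ∉ S → a ≠ b →
    z (insert a S) + z (insert b S) ≤ z (insert a (insert b S)) + z S

theorem IsSupermodular.marginal_mono {d : ℕ} {z : Finset (Fin d) → ℝ} (hz : IsSupermodular z)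
    {S D : Finset (Fin d)} (hSD : S ⊆ D) {j : Fin d} (hj : j ∉ D) :
    z (insert j S) - z S ≤ z (insert j D) - z D := by
  obtain ⟨E, rfl⟩ : ∃ E, D = S ∪ E := ⟨D, (union_eq_right.2 hSD).symm⟩
  clear hSD
  induction E using Finset.induction_on with
  | empty => simp
  | insert a E _ ih =>
    rw [union_insert] at hj ⊢
    have hjE : j ∉ S ∪ E := fun h => hj (mem_insert_of_mem h)
    by_cases ha : a ∈ S ∪ E
    · rw [insert_eq_of_mem ha]
      exact ih hjE
    · linarith [ih hjE, hz (S ∪ E) j a hjE ha fun h => hj (h ▸ mem_insert_self j _)]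

/-- The vertex produced by the greedy algorithm for the set function `z` and the linear order on
the coordinates given by `τ`. -/
def greedyVertex {d : ℕ} (z : Finset (Fin d) → ℝ) (τ : Equiv.Perm (Fin d)) : Fin d → ℝ :=
  fun j => z (insert j ({k | τ k < τ j} : Finset (Fin d))) - z {k | τ k < τ j}

/-- The convex hull of all greedy vertices; for supermodular `z` this is the base polytope. -/
def greedyPolytope {d : ℕ} (z : Finset (Fin d) → ℝ) : Set (Fin d → ℝ) :=
  convexHull ℝ (Set.range (greedyVertex z))

section greedy

variable {d : ℕ} {z : Finset (Fin d) → ℝ}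

theorem sum_greedyVertex_of_initial (h0 : z ∅ = 0) (τ : Equiv.Perm (Fin d))
    (I : Finset (Fin d)) (hI : ∀ i j, τ i < τ j → j ∈ I → i ∈ I) :
    ∑ i ∈ I, greedyVertex z τ i = z I := by
  induction I using Finset.induction_on_max_value τ with
  | empty => simp [h0]
  | insert a s ha hmax ih =>
    have hs : ({k | τ k < τ a} : Finset (Fin d)) = s := by
      ext k
      simp only [mem_filter_univ]
      refine ⟨fun hk => ?_, fun hk => lt_of_le_of_ne (hmax k hk) fun h => ha (τ.injective h ▸ hk)⟩
      exact (mem_insert.1 (hI k a hk (mem_insert_self a s))).resolve_left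
        fun h => hk.ne (congrArg τ h)
    have hinit : ∀ i j, τ i < τ j → j ∈ s → i ∈ s := fun i j hij hj =>
      (mem_insert.1 (hI i j hij (mem_insert_of_mem hj))).resolve_left
        fun h => (hij.trans_le (hmax j hj)).ne (congrArg τ h)
    rw [sum_insert ha, ih hinit]
    rw [greedyVertex, hs]
    ring

theorem le_sum_greedyVertex (h0 : z ∅ = 0) (hz : IsSupermodular z) (τ : Equiv.Perm (Fin d))
    (I : Finset (Fin d)) : z I ≤ ∑ i ∈ I, greedyVertex z τ i := by
  induction I using Finset.induction_on_max_value τ with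
  | empty => simp [h0]
  | insert a s ha hmax ih =>
    have hs : s ⊆ ({k | τ k < τ a} : Finset (Fin d)) := fun k hk => by
      simpa using lt_of_le_of_ne (hmax k hk) fun h => ha (τ.injective h ▸ hk)
    rw [sum_insert ha, greedyVertex]
    have := hz.marginal_mono hs (j := a) (by simp)
    linarith

theorem dotProduct_greedyVertex_le (h0 : z ∅ = 0) (hz : IsSupermodular z)
    (τ σ : Equiv.Perm (Fin d)) (u : Fin d → ℝ) (hu : ∀ i j, τ i < τ j → u j ≤ u i) :
    u ⬝ᵥ greedyVertex z τ ≤ u ⬝ᵥ greedyVertex z σ := by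
  have hnn : ∀ u : Fin d → ℝ, 0 ≤ u → (∀ i j, τ i < τ j → u j ≤ u i) →
      u ⬝ᵥ greedyVertex z τ ≤ u ⬝ᵥ greedyVertex z σ := by
    refine nonneg_induction (by simp) fun u I m hu hm hI ih hw => ?_
    have hinit : ∀ i j, τ i < τ j → j ∈ I → i ∈ I := fun i j hij hj => by
      by_contra hi
      have := hw i j hij
      simp only [Pi.add_apply, Pi.smul_apply, indVec, hi, hj, hI i hi, if_true, if_false,
        smul_eq_mul] at this
      linarith [show 0 ≤ u j from hu j]
    have hu' : ∀ i j, τ i < τ j → u j ≤ u i := fun i j hij => by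
      by_cases hj : j ∈ I
      · simpa [indVec, hj, hinit i j hij hj] using hw i j hij
      · rw [hI j hj]
        exact hu i
    rw [add_dotProduct, add_dotProduct, smul_dotProduct, smul_dotProduct, indVec_dotProduct,
      indVec_dotProduct, sum_greedyVertex_of_initial h0 τ I hinit]
    exact add_le_add (ih hu')
      (smul_le_smul_of_nonneg_left (le_sum_greedyVertex h0 hz σ I) hm.le)
  obtain ⟨c, hc⟩ : ∃ c : ℝ, ∀ i, -c ≤ u i :=
    ⟨∑ i, |u i|, fun i => by
      have := single_le_sum (fun j _ => abs_nonneg (u j)) (mem_univ i)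
      linarith [neg_abs_le (u i)]⟩
  have h1 := hnn (u + c • indVec univ) (fun i => by
    simp [indVec]; linarith [hc i]) (fun i j hij => by simpa [indVec] using hu i j hij)
  rw [add_dotProduct, add_dotProduct, smul_dotProduct, smul_dotProduct, indVec_dotProduct,
    indVec_dotProduct, sum_greedyVertex_of_initial h0 τ _ (by simp),
    sum_greedyVertex_of_initial h0 σ _ (by simp)] at h1
  linarith

theorem isPolytope_greedyPolytope : IsPolytope (greedyPolytope z) := by
  classical
  exact ⟨univ.image (greedyVertex z), by simp [greedyPolytope]⟩

theorem lowerSupport_greedyPolytope (h0 : z ∅ = 0) (hz : IsSupermodular z)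
    (τ : Equiv.Perm (Fin d)) (u : Fin d → ℝ) (hu : ∀ i j, τ i < τ j → u j ≤ u i) :
    lowerSupport (greedyPolytope z) u = u ⬝ᵥ greedyVertex z τ := by
  refine lowerSupport_eq_of_forall_le isPolytope_greedyPolytope.isCompact
    (subset_convexHull ℝ _ ⟨τ, rfl⟩) fun y hy => ?_
  have hconv : Convex ℝ {y : Fin d → ℝ | u ⬝ᵥ greedyVertex z τ ≤ u ⬝ᵥ y} :=
    convex_halfSpace_ge ⟨dotProduct_add u, fun c y => dotProduct_smul c u y⟩ _
  refine convexHull_min ?_ hconv hy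
  rintro _ ⟨σ, rfl⟩
  exact dotProduct_greedyVertex_le h0 hz τ σ u hu

theorem exists_perm_sort (u : Fin d → ℝ) :
    ∃ τ : Equiv.Perm (Fin d), ∀ i j, τ i < τ j → u j ≤ u i := by
  refine ⟨(Tuple.sort (-u)).symm, fun i j hij => ?_⟩
  have := Tuple.monotone_sort (-u) hij.le
  simpa using this

theorem isBraidBody_greedyPolytope (h0 : z ∅ = 0) (hz : IsSupermodular z) :
    IsBraidBody (greedyPolytope z) where
  isCompact := isPolytope_greedyPolytope.isCompact
  convex := isPolytope_greedyPolytope.convex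
  nonempty := ⟨_, subset_convexHull ℝ _ ⟨1, rfl⟩⟩
  lowerSupport_add u v huv := by
    obtain ⟨τ, hτ⟩ := exists_perm_sort (u + v)
    have hu : ∀ i j, τ i < τ j → u j ≤ u i := fun i j hij => by
      by_contra! h
      have := hτ i j hij
      have := huv.symm h
      simp only [Pi.add_apply] at *
      linarith
    have hv : ∀ i j, τ i < τ j → v j ≤ v i := fun i j hij => by
      by_contra! h
      have := hτ i j hij
      have := huv h
      simp only [Pi.add_apply] at *
      linarith
    rw [lowerSupport_greedyPolytope h0 hz τ _ hτ, lowerSupport_greedyPolytope h0 hz τ _ hu,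
      lowerSupport_greedyPolytope h0 hz τ _ hv, add_dotProduct]

theorem lowerSupport_greedyPolytope_indVec (h0 : z ∅ = 0) (hz : IsSupermodular z)
    (I : Finset (Fin d)) : lowerSupport (greedyPolytope z) (indVec I) = z I := by
  obtain ⟨τ, hτ⟩ := exists_perm_sort (indVec I)
  rw [lowerSupport_greedyPolytope h0 hz τ _ hτ, indVec_dotProduct]
  refine sum_greedyVertex_of_initial h0 τ I fun i j hij hj => ?_
  by_contra hi
  have := hτ i j hij
  simp [indVec, hi, hj] at this
  linarith

end greedy

/-- The supermodular function of the permutahedron. -/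
noncomputable def triangular {d : ℕ} (I : Finset (Fin d)) : ℝ := #I * (#I + 1) / 2

section genPerm

variable {d : ℕ} {P Q : Set (Fin d → ℝ)}

theorem triangular_local {S : Finset (Fin d)} {a b : Fin d} (ha : a ∉ S) (hb : b ∉ S)
    (hab : a ≠ b) : triangular (insert a (insert b S)) + triangular S =
      triangular (insert a S) + triangular (insert b S) + 1 := by
  have hab' : a ∉ insert b S := by simp [ha, hab]
  simp only [triangular, card_insert_of_notMem ha, card_insert_of_notMem hb,
    card_insert_of_notMem hab']
  push_cast
  ring

theorem isSupermodular_triangular : IsSupermodular (triangular (d := d)) :=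
  fun S a b ha hb hab => by linarith [triangular_local ha hb hab]

theorem greedyVertex_triangular (τ : Equiv.Perm (Fin d)) :
    greedyVertex triangular τ = fun i => ((τ i : ℕ) + 1 : ℝ) := by
  funext j
  have hcard : #{k | τ k < τ j} = (τ j : ℕ) := by
    rw [← card_map τ.toEmbedding, ← Fin.card_Iio (τ j)]
    congr 1
    ext k
    simp only [mem_map_equiv, mem_filter_univ, Equiv.apply_symm_apply, mem_Iio]
  rw [greedyVertex, triangular, triangular, card_insert_of_notMem (by simp), hcard]
  push_cast
  ring

theorem permutahedron_eq_greedyPolytope :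
    permutahedron d = greedyPolytope triangular := by
  unfold permutahedron greedyPolytope
  congr 1
  ext x
  simp [greedyVertex_triangular, eq_comm]

theorem isBraidBody_permutahedron : IsBraidBody (permutahedron d) := by
  rw [permutahedron_eq_greedyPolytope]
  exact isBraidBody_greedyPolytope (by simp [triangular]) isSupermodular_triangular

theorem isPolytope_permutahedron : IsPolytope (permutahedron d) := by
  rw [permutahedron_eq_greedyPolytope]
  exact isPolytope_greedyPolytope

theorem IsGenPerm.isBraidBody (hP : IsGenPerm P) : IsBraidBody P := by
  obtain ⟨hP, lam, hlam, Q, hQ, h⟩ := hP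
  exact .of_add hP.isCompact hP.convex hQ.isCompact (h ▸ isBraidBody_permutahedron.smul hlam.le)

theorem isGenPerm_greedyPolytope {z : Finset (Fin d) → ℝ} (h0 : z ∅ = 0)
    (hz : IsSupermodular z) : IsGenPerm (greedyPolytope z) := by
  set lam : ℝ := 1 + 4 * ∑ I, |z I| with hlam
  have hsum : 0 ≤ ∑ I, |z I| := sum_nonneg fun _ _ => abs_nonneg _
  have hlam0 : 0 < lam := by positivity
  have hbound : ∀ I, |z I| ≤ ∑ I, |z I| := fun I =>
    single_le_sum (fun J _ => abs_nonneg (z J)) (mem_univ I)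
  set w : Finset (Fin d) → ℝ := fun I => lam * triangular I - z I with hw
  have hw0 : w ∅ = 0 := by simp [hw, h0, triangular]
  have hws : IsSupermodular w := fun S a b ha hb hab => by
    have h1 := congrArg (lam * ·) (triangular_local ha hb hab)
    simp only [mul_add] at h1
    have h2 := abs_le.1 (hbound (insert a S))
    have h3 := abs_le.1 (hbound (insert b S))
    have h4 := abs_le.1 (hbound (insert a (insert b S)))
    have h5 := abs_le.1 (hbound S)
    simp only [hw]
    linarith
  have hzb := isBraidBody_greedyPolytope h0 hz
  have hwb := isBraidBody_greedyPolytope hw0 hws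
  refine ⟨isPolytope_greedyPolytope, lam, hlam0, greedyPolytope w, isPolytope_greedyPolytope, ?_⟩
  refine (hzb.add hwb).eq_of_indVec (isBraidBody_permutahedron.smul hlam0.le) fun I => ?_
  rw [lowerSupport_add_set hzb.isCompact hzb.nonempty hwb.isCompact hwb.nonempty,
    lowerSupport_smul_set hlam0.le, permutahedron_eq_greedyPolytope,
    lowerSupport_greedyPolytope_indVec h0 hz, lowerSupport_greedyPolytope_indVec hw0 hws,
    lowerSupport_greedyPolytope_indVec (by simp [triangular]) isSupermodular_triangular]
  simp [hw]

theorem isGenPerm_singleton (t : Fin d → ℝ) : IsGenPerm ({t} : Set (Fin d → ℝ)) :=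
  ⟨isPolytope_singleton t, 1, one_pos, {-t} + permutahedron d,
    (isPolytope_singleton _).add isPolytope_permutahedron, by
      rw [← add_assoc, Set.singleton_add_singleton, add_neg_cancel, one_smul]
      exact zero_add _⟩

theorem IsGenPerm.add (hP : IsGenPerm P) (hQ : IsGenPerm Q) : IsGenPerm (P + Q) := by
  obtain ⟨hP, lam, hlam, P', hP', h⟩ := hP
  obtain ⟨hQ, mu, hmu, Q', hQ', h'⟩ := hQ
  refine ⟨hP.add hQ, lam + mu, add_pos hlam hmu, P' + Q', hP'.add hQ', ?_⟩
  rw [add_add_add_comm, h, h', isBraidBody_permutahedron.convex.add_smul hlam.le hmu.le]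

theorem IsGenPerm.smul (hP : IsGenPerm P) {c : ℝ} (hc : 0 ≤ c) : IsGenPerm (c • P) := by
  rcases hc.eq_or_lt with rfl | hc
  · rw [Set.zero_smul_set hP.isBraidBody.nonempty]
    exact isGenPerm_singleton 0
  · obtain ⟨hP, lam, hlam, Q, hQ, h⟩ := hP
    exact ⟨hP.smul c, c * lam, mul_pos hc hlam, c • Q, hQ.smul c, by
      rw [← smul_add, h, smul_smul]⟩

theorem isPolytope_stdSimp (J : Finset (Fin d)) : IsPolytope (stdSimp d J) := by
  classical
  exact ⟨J.image fun i => Pi.single i 1, by rw [stdSimp, coe_image]⟩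

theorem lowerSupport_stdSimp {J : Finset (Fin d)} {u : Fin d → ℝ} {i : Fin d} (hi : i ∈ J)
    (hmin : ∀ j ∈ J, u i ≤ u j) : lowerSupport (stdSimp d J) u = u i := by
  rw [lowerSupport_eq_of_forall_le (isPolytope_stdSimp J).isCompact
    (subset_convexHull ℝ _ ⟨i, hi, rfl⟩) fun y hy => ?_]
  · simp
  · have hconv : Convex ℝ {y : Fin d → ℝ | u ⬝ᵥ Pi.single i 1 ≤ u ⬝ᵥ y} :=
      convex_halfSpace_ge ⟨dotProduct_add u, fun c y => dotProduct_smul c u y⟩ _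
    refine convexHull_min ?_ hconv hy
    rintro _ ⟨j, hj, rfl⟩
    simpa using hmin j hj

theorem lowerSupport_stdSimp_indVec {J : Finset (Fin d)} (hJ : J.Nonempty) (I : Finset (Fin d)) :
    lowerSupport (stdSimp d J) (indVec I) = if J ⊆ I then 1 else 0 := by
  split_ifs with h
  · obtain ⟨i, hi⟩ := hJ
    rw [lowerSupport_stdSimp hi fun j hj => by simp [indVec, h hi, h hj]]
    simp [indVec, h hi]
  · obtain ⟨i, hi, hiI⟩ := not_subset.1 h
    rw [lowerSupport_stdSimp hi fun j hj => by
      simp only [indVec, hiI, if_false]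
      split_ifs <;> norm_num]
    simp [indVec, hiI]

theorem isBraidBody_stdSimp {J : Finset (Fin d)} (hJ : J.Nonempty) :
    IsBraidBody (stdSimp d J) where
  isCompact := (isPolytope_stdSimp J).isCompact
  convex := (isPolytope_stdSimp J).convex
  nonempty := by
    obtain ⟨i, hi⟩ := hJ
    exact ⟨_, subset_convexHull ℝ _ ⟨i, hi, rfl⟩⟩
  lowerSupport_add u v huv := by
    obtain ⟨i, hi, hmin⟩ := exists_min_image J (u + v) hJ
    have hu : ∀ j ∈ J, u i ≤ u j := fun j hj => by
      by_contra! h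
      have := hmin j hj
      have := huv.symm h
      simp only [Pi.add_apply] at *
      linarith
    have hv : ∀ j ∈ J, v i ≤ v j := fun j hj => by
      by_contra! h
      have := hmin j hj
      have := huv h
      simp only [Pi.add_apply] at *
      linarith
    rw [lowerSupport_stdSimp hi hmin, lowerSupport_stdSimp hi hu, lowerSupport_stdSimp hi hv,
      Pi.add_apply]

theorem isGenPerm_stdSimp {J : Finset (Fin d)} (hJ : J.Nonempty) : IsGenPerm (stdSimp d J) := by
  have hb := isBraidBody_stdSimp hJ
  set z : Finset (Fin d) → ℝ := fun I => lowerSupport (stdSimp d J) (indVec I) with hz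
  have h0 : z ∅ = 0 := hb.lowerSupport_empty
  have hs : IsSupermodular z := fun S a b ha _ hab => hb.supermodular ha hab
  rw [hb.eq_of_indVec (isBraidBody_greedyPolytope h0 hs)
    fun I => (lowerSupport_greedyPolytope_indVec h0 hs I).symm]
  exact isGenPerm_greedyPolytope h0 hs

end genPerm

section functional

variable {d : ℕ} {φ : Set (Fin d → ℝ) → ℝ}

/-- Minkowski linearity on generalized permutahedra. -/
def IsMinkowskiLinear (φ : Set (Fin d → ℝ) → ℝ) : Prop :=
  ∀ P Q : Set (Fin d → ℝ), IsGenPerm P → IsGenPerm Q → ∀ lam mu : ℝ,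
    0 ≤ lam → 0 ≤ mu → φ (lam • P + mu • Q) = lam * φ P + mu * φ Q

theorem IsMinkowskiLinear.map_add (hφ : IsMinkowskiLinear φ) {P Q : Set (Fin d → ℝ)}
    (hP : IsGenPerm P) (hQ : IsGenPerm Q) : φ (P + Q) = φ P + φ Q := by
  simpa using hφ P Q hP hQ 1 1 zero_le_one zero_le_one

theorem IsMinkowskiLinear.map_zero (hφ : IsMinkowskiLinear φ) : φ {0} = 0 := by
  simpa using hφ {0} {0} (isGenPerm_singleton 0) (isGenPerm_singleton 0) 0 0 le_rfl le_rfl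

theorem IsMinkowskiLinear.map_sum_smul_stdSimp (hφ : IsMinkowskiLinear φ)
    (s : Finset (Finset (Fin d))) (hs : ∀ J ∈ s, J.Nonempty) {w : Finset (Fin d) → ℝ}
    (hw : ∀ J, 0 ≤ w J) :
    IsGenPerm (∑ J ∈ s, w J • stdSimp d J) ∧
      φ (∑ J ∈ s, w J • stdSimp d J) = ∑ J ∈ s, w J * φ (stdSimp d J) ∧
      ∀ I, lowerSupport (∑ J ∈ s, w J • stdSimp d J) (indVec I) =
        ∑ J ∈ s, w J * if J ⊆ I then 1 else 0 := by
  induction s using Finset.induction_on with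
  | empty =>
    refine ⟨isGenPerm_singleton 0, hφ.map_zero, fun I => ?_⟩
    simp [lowerSupport, ← Set.singleton_zero]
  | insert K s hK ih =>
    obtain ⟨h1, h2, h3⟩ := ih fun J hJ => hs J (mem_insert_of_mem hJ)
    have hKne := hs K (mem_insert_self K s)
    have hKg := isGenPerm_stdSimp hKne
    have hKw := hKg.smul (hw K)
    simp only [sum_insert hK]
    refine ⟨hKw.add h1, ?_, fun I => ?_⟩
    · rw [← h2]
      simpa using hφ _ _ hKg h1 (w K) 1 (hw K) zero_le_one
    · rw [lowerSupport_add_set hKw.isBraidBody.isCompact hKw.isBraidBody.nonempty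
        h1.isBraidBody.isCompact h1.isBraidBody.nonempty, h3, lowerSupport_smul_set (hw K),
        lowerSupport_stdSimp_indVec hKne]

/-- A generalized permutahedron is a signed Minkowski sum of simplices; correspondingly for the
values of a Minkowski linear functional. -/
theorem IsMinkowskiLinear.eq_sum (hφ : IsMinkowskiLinear φ)
    {P : Set (Fin d → ℝ)} (hP : IsGenPerm P) {y : Finset (Fin d) → ℝ}
    (hy : ∀ I, lowerSupport P (indVec I) = ∑ J, y J * if J ⊆ I then 1 else 0) :
    φ P = ∑ J, y J * φ (stdSimp d J) := by
  set s : Finset (Finset (Fin d)) := {J | J.Nonempty} with hs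
  have hsne : ∀ J ∈ s, J.Nonempty := fun J hJ => by simpa [hs] using hJ
  have hy0 : y ∅ = 0 := by
    simpa [hP.isBraidBody.lowerSupport_empty, eq_comm] using hy ∅
  have hsum : ∀ q : Finset (Fin d) → ℝ, ∑ J, y J * q J = ∑ J ∈ s, y J * q J := fun q => by
    refine (sum_filter_of_ne fun J _ hJ => nonempty_iff_ne_empty.2 ?_).symm
    rintro rfl
    exact hJ (by rw [hy0, zero_mul])
  obtain ⟨hn1, hn2, hn3⟩ := hφ.map_sum_smul_stdSimp s hsne (w := fun J => max (-y J) 0)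
    fun J => le_max_right _ _
  obtain ⟨hp1, hp2, hp3⟩ := hφ.map_sum_smul_stdSimp s hsne (w := fun J => max (y J) 0)
    fun J => le_max_right _ _
  have hsplit : ∀ q : Finset (Fin d) → ℝ, ∑ J ∈ s, y J * q J + ∑ J ∈ s, max (-y J) 0 * q J =
      ∑ J ∈ s, max (y J) 0 * q J := fun q => by
    rw [← sum_add_distrib]
    refine sum_congr rfl fun J _ => ?_
    linear_combination -q J * max_zero_sub_max_neg_zero_eq_self (y J)
  have heq := (hP.isBraidBody.add hn1.isBraidBody).eq_of_indVec hp1.isBraidBody fun I => by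
    rw [lowerSupport_add_set hP.isBraidBody.isCompact hP.isBraidBody.nonempty
      hn1.isBraidBody.isCompact hn1.isBraidBody.nonempty, hn3, hp3, hy, hsum, hsplit]
  have := congrArg φ heq
  rw [hφ.map_add hP hn1, hn2, hp2, ← hsplit fun J => φ (stdSimp d J)] at this
  rw [hsum]
  linarith

theorem exists_sum_subset_eq (z : Finset (Fin d) → ℝ) :
    ∃ y : Finset (Fin d) → ℝ, ∀ I, z I = ∑ J, y J * if J ⊆ I then 1 else 0 := by
  refine ⟨Finset.strongInduction fun I y => z I - ∑ J ∈ I.ssubsets.attach,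
    y J.1 (mem_ssubsets.1 J.2), fun I => ?_⟩
  simp only [mul_ite, mul_one, mul_zero]
  rw [← sum_filter, show ({J | J ⊆ I} : Finset (Finset (Fin d))) = insert I I.ssubsets by
    ext J
    simp [le_iff_eq_or_lt (a := J) (b := I)],
    sum_insert (by simp), Finset.strongInduction_eq]
  rw [sum_attach _ (fun J => Finset.strongInduction _ J)]
  ring

theorem sum_interval (y : Finset (Fin d) → ℝ) {S : Finset (Fin d)} {a b : Fin d} (ha : a ∉ S)
    (hb : b ∉ S) (hab : a ≠ b) :
    (∑ J, y J * if {a, b} ⊆ J ∧ J ⊆ insert a (insert b S) then 1 else 0) =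
      (∑ J, y J * if J ⊆ insert a (insert b S) then 1 else 0)
        + (∑ J, y J * if J ⊆ S then 1 else 0)
        - (∑ J, y J * if J ⊆ insert a S then 1 else 0)
        - ∑ J, y J * if J ⊆ insert b S then 1 else 0 := by
  rw [← sum_add_distrib, ← sum_sub_distrib, ← sum_sub_distrib]
  refine sum_congr rfl fun J _ => ?_
  rw [← mul_add, ← mul_sub, ← mul_sub]
  congr 1
  have hS : a ∈ J ∨ b ∈ J → ¬ J ⊆ S := fun h hJ => h.elim (fun h => ha (hJ h)) fun h => hb (hJ h)
  have hA : b ∈ J → ¬ J ⊆ insert a S := fun h hJ => by simpa [hab.symm, hb] using hJ h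
  have hB : a ∈ J → ¬ J ⊆ insert b S := fun h hJ => by simpa [hab, ha] using hJ h
  by_cases haJ : a ∈ J
  · by_cases hbJ : b ∈ J
    · simp [haJ, hbJ, hS, hA, hB, insert_subset_iff]
    · simp [haJ, hbJ, hS, hB, insert_subset_iff, insert_comm a b,
        subset_insert_iff_of_notMem hbJ]
  · by_cases hbJ : b ∈ J
    · simp [haJ, hbJ, hS, hA, insert_subset_iff, subset_insert_iff_of_notMem haJ]
    · simp [haJ, insert_subset_iff, subset_insert_iff_of_notMem haJ,
        subset_insert_iff_of_notMem hbJ]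

theorem isSupermodular_sum_iff (y : Finset (Fin d) → ℝ) :
    IsSupermodular (fun I => ∑ J, y J * if J ⊆ I then 1 else 0) ↔
      ∀ E T : Finset (Fin d), #E = 2 → E ⊆ T →
        0 ≤ ∑ J, y J * if E ⊆ J ∧ J ⊆ T then 1 else 0 := by
  constructor
  · intro h E T hE hET
    obtain ⟨a, b, hab, rfl⟩ := card_eq_two.1 hE
    obtain ⟨S, ha, hb, rfl⟩ : ∃ S, a ∉ S ∧ b ∉ S ∧ T = insert a (insert b S) :=
      ⟨T \ {a, b}, by simp, by simp, by
        conv_lhs => rw [← sdiff_union_of_subset hET]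
        grind⟩
    rw [sum_interval y ha hb hab]
    linarith [h S a b ha hb hab]
  · intro h S a b ha hb hab
    have := h {a, b} (insert a (insert b S)) (card_pair hab) (by grind)
    rw [sum_interval y ha hb hab] at this
    simp only
    linarith

theorem IsMinkowskiLinear.nonneg_of_interval_sum (hφ : IsMinkowskiLinear φ) (h0 : φ ∅ = 0)
    {c : Finset (Fin d) × Finset (Fin d) → ℝ}
    (hc : ∀ E T : Finset (Fin d), #E = 2 → E ⊆ T → 0 ≤ c (E, T))
    (h : ∀ I : Finset (Fin d), I.Nonempty →
      φ (stdSimp d I) = ∑ p with #p.1 = 2 ∧ p.1 ⊆ I ∧ I ⊆ p.2, c p)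
    {P : Set (Fin d → ℝ)} (hP : IsGenPerm P) : 0 ≤ φ P := by
  have h' : ∀ I : Finset (Fin d),
      φ (stdSimp d I) = ∑ p with #p.1 = 2 ∧ p.1 ⊆ I ∧ I ⊆ p.2, c p := fun I => by
    rcases I.eq_empty_or_nonempty with rfl | hI
    · rw [show stdSimp d ∅ = ∅ by simp [stdSimp], h0, filter_false_of_mem, sum_empty]
      rintro p - ⟨hp, hp', -⟩
      simp [subset_empty.1 hp'] at hp
    · exact h I hI
  obtain ⟨y, hy⟩ := exists_sum_subset_eq fun I => lowerSupport P (indVec I)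
  have hsm : IsSupermodular fun I => ∑ J, y J * if J ⊆ I then 1 else 0 := by
    simp only [← hy]
    exact fun S a b ha _ hab => hP.isBraidBody.supermodular ha hab
  rw [hφ.eq_sum hP hy]
  simp only [h', sum_filter, mul_sum]
  rw [sum_comm]
  refine sum_nonneg fun p _ => ?_
  by_cases hp : #p.1 = 2 ∧ p.1 ⊆ p.2
  · have hterm : ∀ J, y J * (if #p.1 = 2 ∧ p.1 ⊆ J ∧ J ⊆ p.2 then c p else 0) =
        c p * (y J * if p.1 ⊆ J ∧ J ⊆ p.2 then 1 else 0) := fun J => by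
      simp only [hp.1, true_and]
      split_ifs <;> ring
    simp only [hterm, ← mul_sum]
    exact mul_nonneg (hc _ _ hp.1 hp.2) ((isSupermodular_sum_iff y).1 hsm _ _ hp.1 hp.2)
  · refine (sum_eq_zero fun J _ => ?_).ge
    rw [if_neg fun hJ => hp ⟨hJ.1, hJ.2.1.trans hJ.2.2⟩, mul_zero]

theorem IsMinkowskiLinear.exists_interval_sum (hφ : IsMinkowskiLinear φ) (h0 : φ ∅ = 0)
    (hnn : ∀ P : Set (Fin d → ℝ), IsGenPerm P → 0 ≤ φ P) :
    ∃ c : Finset (Fin d) × Finset (Fin d) → ℝ, (∀ p, 0 ≤ c p) ∧ ∀ I : Finset (Fin d),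
      φ (stdSimp d I) = ∑ p with #p.1 = 2 ∧ p.1 ⊆ I ∧ I ⊆ p.2, c p := by
  have hempty : φ (stdSimp d ∅) = 0 := by rw [show stdSimp d ∅ = ∅ by simp [stdSimp], h0]
  obtain ⟨c, hc, hg⟩ := exists_nonneg_sum_smul_of_forall_nonneg
    (V := Finset (Fin d) → ℝ)
    ({p | #p.1 = 2 ∧ p.1 ⊆ p.2} : Finset (Finset (Fin d) × Finset (Fin d)))
    (fun p => ∑ J, (if p.1 ⊆ J ∧ J ⊆ p.2 then (1 : ℝ) else 0) • LinearMap.proj J)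
    (∑ J, φ (stdSimp d J) • LinearMap.proj J) fun x hx => by
      set y := Function.update x ∅ 0 with hy
      have hsum : ∀ q : Finset (Fin d) → ℝ, q ∅ = 0 → ∑ J, q J * x J = ∑ J, y J * q J :=
        fun q hq => sum_congr rfl fun J _ => by
          by_cases hJ : J = ∅
          · simp [hJ, hq]
          · rw [hy, Function.update_of_ne hJ, mul_comm]
      simp only [LinearMap.coe_sum, Finset.sum_apply, LinearMap.smul_apply, LinearMap.proj_apply,
        smul_eq_mul, mem_filter_univ] at hx ⊢
      set z : Finset (Fin d) → ℝ := fun I => ∑ J, y J * if J ⊆ I then 1 else 0 with hz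
      have hz0 : z ∅ = 0 := by simp [hz, hy]
      have hzs : IsSupermodular z := (isSupermodular_sum_iff y).2 fun E T hE hET => by
        have := hx (E, T) ⟨hE, hET⟩
        rwa [hsum (fun J => if E ⊆ J ∧ J ⊆ T then 1 else 0) (if_neg fun h => by
          simp [subset_empty.1 h.1] at hE)] at this
      have hgp := isGenPerm_greedyPolytope hz0 hzs
      rw [hsum (fun J => φ (stdSimp d J)) hempty, ← hφ.eq_sum hgp
        fun I => lowerSupport_greedyPolytope_indVec hz0 hzs I]
      exact hnn _ hgp
  refine ⟨c, hc, fun I => ?_⟩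
  have := LinearMap.congr_fun hg (Pi.single I 1)
  simp only [LinearMap.coe_sum, Finset.sum_apply, LinearMap.smul_apply, LinearMap.proj_apply,
    smul_eq_mul, Pi.single_apply, mul_ite, mul_one, mul_zero, sum_ite_eq', mem_univ,
    if_true] at this
  rw [this, ← sum_filter, filter_filter]
  refine sum_congr (filter_congr fun p _ => ?_) fun _ _ => rfl
  exact ⟨fun h => ⟨h.1.1, h.2⟩, fun h => ⟨⟨h.1, h.2.1.trans h.2.2⟩, h.2⟩⟩

end functional

theorem stmt2 (d : ℕ) (hd : 2 ≤ d) (φ : Set (Fin d → ℝ) → ℝ)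
    (hφ0 : φ ∅ = 0)
    (hlin : ∀ P Q : Set (Fin d → ℝ), IsGenPerm P → IsGenPerm Q → ∀ lam mu : ℝ,
      0 ≤ lam → 0 ≤ mu → φ (lam • P + mu • Q) = lam * φ P + mu * φ Q) :
    ((∀ P : Set (Fin d → ℝ), IsGenPerm P → 0 ≤ φ P) ∧
      (∀ (P : Set (Fin d → ℝ)) (t : Fin d → ℝ), IsGenPerm P → φ (P + {t}) = φ P))
    ↔ (∃ c : Finset (Fin d) → Finset (Fin d) → ℝ,
        (∀ E T : Finset (Fin d), E.card = 2 → E ⊆ T → 0 ≤ c E T) ∧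
        ∀ I : Finset (Fin d), I.Nonempty →
          φ (stdSimp d I) = ∑ p ∈ (univ ×ˢ univ).filter
            (fun p : Finset (Fin d) × Finset (Fin d) => p.1.card = 2 ∧ p.1 ⊆ I ∧ I ⊆ p.2),
            c p.1 p.2) := by
  have hφ : IsMinkowskiLinear φ := hlin
  simp only [univ_product_univ]
  constructor
  · rintro ⟨hnn, -⟩
    obtain ⟨c, hc, h⟩ := hφ.exists_interval_sum hφ0 hnn
    exact ⟨fun E T => c (E, T), fun E T _ _ => hc _, fun I _ => h I⟩
  · rintro ⟨c, hc, h⟩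
    have hnn : ∀ P : Set (Fin d → ℝ), IsGenPerm P → 0 ≤ φ P := fun P hP =>
      hφ.nonneg_of_interval_sum hφ0 (c := fun p => c p.1 p.2) hc h hP
    refine ⟨hnn, fun P t hP => ?_⟩
    have ht := hnn _ (isGenPerm_singleton t)
    have ht' := hnn _ (isGenPerm_singleton (-t))
    have hsum := hφ.map_add (isGenPerm_singleton t) (isGenPerm_singleton (-t))
    rw [Set.singleton_add_singleton, add_neg_cancel, hφ.map_zero] at hsum
    rw [hφ.map_add hP (isGenPerm_singleton t)]
    linarith
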